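/- Let R be a ring with finite Gorenstein weak dimension, and let N be an R-module admitting a short exact sequence 0 → N → F → N → 0 with F flat. Then Tor^R_1(N, I) = 0 for every injective R-module I, and hence N is strongly Gorenstein flat. -/

import Mathlib

universe u

open LinearMap DirectSum

section Defs

variable (R : Type u) [CommRing R]

/-- `Ext¹_R(M, Q) = 0`, expressed by the splitting of all extensions of `M` by `Q`. -/
def Ext1Zero (M Q : Type u) [AddCommGroup M] [Module R M] [AddCommGroup Q] [Module R Q] :
    Prop :=
  ∀ (E : ModuleCat.{u} R) (i : Q →ₗ[R] E) (p : E →ₗ[R] M),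
    Function.Injective i → Function.Surjective p → LinearMap.range i = LinearMap.ker p →
      ∃ s : M →ₗ[R] E, p ∘ₗ s = LinearMap.id

/-- `Tor₁^R(M, N) = 0`, expressed via flat presentations of `N`:
for every surjection `p : F ↠ N` with `F` flat, `ker p ⊗ M → F ⊗ M` is injective. -/
def Tor1Zero (M N : Type u) [AddCommGroup M] [Module R M] [AddCommGroup N] [Module R N] :
    Prop :=
  ∀ (F : ModuleCat.{u} R), Module.Flat R F →
    ∀ p : F →ₗ[R] N, Function.Surjective p →
      Function.Injective (LinearMap.rTensor M (LinearMap.ker p).subtype)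

/-- `M` is strongly Gorenstein projective: there is an exact complex
`⋯ → P → P → P → ⋯` with a single projective `P` and single differential `f`,
which stays exact under `Hom(-, Q)` for every projective `Q`, and `M ≅ Im f`. -/
def IsSGProjective (M : Type u) [AddCommGroup M] [Module R M] : Prop :=
  ∃ P : ModuleCat.{u} R, Module.Projective R P ∧
    ∃ f : P →ₗ[R] P, f ∘ₗ f = 0 ∧ LinearMap.ker f = LinearMap.range f ∧
      Nonempty (M ≃ₗ[R] LinearMap.range f) ∧
      ∀ Q : ModuleCat.{u} R, Module.Projective R Q →
        ∀ g : P →ₗ[R] Q, g ∘ₗ f = 0 → ∃ h : P →ₗ[R] Q, g = h ∘ₗ f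

/-- `M` is strongly Gorenstein flat: there is an exact complex
`⋯ → F → F → F → ⋯` with a single flat `F` and single differential `f`,
which stays exact under `- ⊗ I` for every injective `I`, and `M ≅ Im f`. -/
def IsSGFlat (M : Type u) [AddCommGroup M] [Module R M] : Prop :=
  ∃ F : ModuleCat.{u} R, Module.Flat R F ∧
    ∃ f : F →ₗ[R] F, f ∘ₗ f = 0 ∧ LinearMap.ker f = LinearMap.range f ∧
      Nonempty (M ≃ₗ[R] LinearMap.range f) ∧
      ∀ I : ModuleCat.{u} R, Module.Injective R I →
        LinearMap.ker (LinearMap.rTensor I f) = LinearMap.range (LinearMap.rTensor I f)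

/-- `M` is Gorenstein projective: it is a syzygy of a totally acyclic complex of
projective modules. -/
def IsGProjective (M : Type u) [AddCommGroup M] [Module R M] : Prop :=
  ∃ (P : ℤ → ModuleCat.{u} R) (d : ∀ i : ℤ, P (i + 1) →ₗ[R] P i),
    (∀ i, Module.Projective R (P i)) ∧
    (∀ i, d i ∘ₗ d (i + 1) = 0) ∧
    (∀ i, LinearMap.ker (d i) = LinearMap.range (d (i + 1))) ∧
    Nonempty (M ≃ₗ[R] LinearMap.range (d 0)) ∧
    ∀ Q : ModuleCat.{u} R, Module.Projective R Q →
      ∀ (i : ℤ) (g : P (i + 1) →ₗ[R] Q), g ∘ₗ d (i + 1) = 0 →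
        ∃ h : P i →ₗ[R] Q, g = h ∘ₗ d i

/-- `M` is Gorenstein flat: it is a syzygy of an exact complex of flat modules
which stays exact under `- ⊗ I` for every injective `I`. -/
def IsGFlat (M : Type u) [AddCommGroup M] [Module R M] : Prop :=
  ∃ (F : ℤ → ModuleCat.{u} R) (d : ∀ i : ℤ, F (i + 1) →ₗ[R] F i),
    (∀ i, Module.Flat R (F i)) ∧
    (∀ i, d i ∘ₗ d (i + 1) = 0) ∧
    (∀ i, LinearMap.ker (d i) = LinearMap.range (d (i + 1))) ∧
    Nonempty (M ≃ₗ[R] LinearMap.range (d 0)) ∧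
    ∀ I : ModuleCat.{u} R, Module.Injective R I →
      ∀ i : ℤ, LinearMap.ker (LinearMap.rTensor I (d i)) =
        LinearMap.range (LinearMap.rTensor I (d (i + 1)))

/-- A class of `R`-modules is projectively resolving if it contains the projectives and,
in every short exact sequence `0 → A → B → C → 0` with `C` in the class, `A` is in the
class iff `B` is. -/
def ProjResolving (X : ModuleCat.{u} R → Prop) : Prop :=
  (∀ P : ModuleCat.{u} R, Module.Projective R P → X P) ∧
  ∀ (A B C : ModuleCat.{u} R) (i : A →ₗ[R] B) (p : B →ₗ[R] C),
    Function.Injective i → Function.Surjective p → LinearMap.range i = LinearMap.ker p →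
      X C → (X A ↔ X B)

/-- Gorenstein projective dimension at most `n`. -/
def GpdLE : ℕ → ModuleCat.{u} R → Prop
  | 0, M => IsGProjective R M
  | n + 1, M => ∃ (G : ModuleCat.{u} R) (p : G →ₗ[R] M),
      IsGProjective R G ∧ Function.Surjective p ∧ GpdLE n (ModuleCat.of R (LinearMap.ker p))

/-- Gorenstein flat dimension at most `n`. -/
def GfdLE : ℕ → ModuleCat.{u} R → Prop
  | 0, M => IsGFlat R M
  | n + 1, M => ∃ (G : ModuleCat.{u} R) (p : G →ₗ[R] M),
      IsGFlat R G ∧ Function.Surjective p ∧ GfdLE n (ModuleCat.of R (LinearMap.ker p))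

/-- Flat dimension at most `n`. -/
def FlatDimLE : ℕ → ModuleCat.{u} R → Prop
  | 0, M => Module.Flat R M
  | n + 1, M => ∃ (G : ModuleCat.{u} R) (p : G →ₗ[R] M),
      Module.Flat R G ∧ Function.Surjective p ∧ FlatDimLE n (ModuleCat.of R (LinearMap.ker p))

/-- Projective dimension at most `n`. -/
def ProjDimLE : ℕ → ModuleCat.{u} R → Prop
  | 0, M => Module.Projective R M
  | n + 1, M => ∃ (G : ModuleCat.{u} R) (p : G →ₗ[R] M),
      Module.Projective R G ∧ Function.Surjective p ∧
        ProjDimLE n (ModuleCat.of R (LinearMap.ker p))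

/-- `R` is a coherent ring: every finitely generated ideal is finitely presented. -/
def IsCoherent : Prop :=
  ∀ I : Ideal R, I.FG → Module.FinitePresentation R I

end Defs

/-- Balancing of the vanishing of Tor: a diagram chase. -/
theorem balance_aux {R : Type u} [CommRing R]
    {A G M X' P X : Type u} [AddCommGroup A] [Module R A] [AddCommGroup G] [Module R G]
    [AddCommGroup M] [Module R M] [AddCommGroup X'] [Module R X'] [AddCommGroup P] [Module R P]
    [AddCommGroup X] [Module R X]
    (a : A →ₗ[R] G) (g : G →ₗ[R] M) (b : X' →ₗ[R] P) (q : P →ₗ[R] X)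
    (hag : Function.Exact a g) (hg : Function.Surjective g)
    (hbq : Function.Exact b q) (hq : Function.Surjective q)
    (hP : Function.Injective (LinearMap.rTensor P a))
    (hM : Function.Injective (LinearMap.rTensor M b)) :
    Function.Injective (LinearMap.rTensor X a) := by
  have hM' : Function.Injective (LinearMap.lTensor M b) :=
    (LinearMap.lTensor_inj_iff_rTensor_inj M b).2 hM
  rw [injective_iff_map_eq_zero]
  intro t ht
  obtain ⟨s, rfl⟩ := LinearMap.lTensor_surjective A hq t
  have h1 : LinearMap.lTensor G q (LinearMap.rTensor P a s) = 0 := by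
    rw [← ht, ← LinearMap.comp_apply, ← LinearMap.comp_apply, LinearMap.lTensor_comp_rTensor,
      LinearMap.rTensor_comp_lTensor]
  obtain ⟨w, hw⟩ := (lTensor_exact G hbq hq _).1 h1
  have h2 : LinearMap.rTensor X' g w = 0 := by
    apply hM'
    rw [map_zero]
    have : LinearMap.lTensor M b (LinearMap.rTensor X' g w) =
        LinearMap.rTensor P g (LinearMap.lTensor G b w) := by
      rw [← LinearMap.comp_apply, ← LinearMap.comp_apply, LinearMap.lTensor_comp_rTensor,
        LinearMap.rTensor_comp_lTensor]
    rw [this, hw]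
    exact (rTensor_exact P hag hg).apply_apply_eq_zero s
  obtain ⟨v, rfl⟩ := (rTensor_exact X' hag hg _).1 h2
  have h3 : LinearMap.lTensor A b v = s := by
    apply hP
    rw [← hw, ← LinearMap.comp_apply, ← LinearMap.comp_apply, LinearMap.lTensor_comp_rTensor,
      LinearMap.rTensor_comp_lTensor]
  rw [← h3]
  exact (lTensor_exact A hbq hq).apply_apply_eq_zero v

/-- The canonical free cover. -/
noncomputable abbrev cov (R : Type u) [CommRing R] (X : Type u) [AddCommGroup X] [Module R X] :
    (X →₀ R) →ₗ[R] X := Finsupp.linearCombination R (id : X → X)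

theorem cov_surj (R : Type u) [CommRing R] (X : Type u) [AddCommGroup X] [Module R X] :
    Function.Surjective (cov R X) := fun x => ⟨Finsupp.single x 1, by simp⟩

section
variable {R : Type u} [CommRing R]
    {A G M X : Type u} [AddCommGroup A] [Module R A] [AddCommGroup G] [Module R G]
    [AddCommGroup M] [Module R M] [AddCommGroup X] [Module R X]

theorem exact_ker_sub (g : G →ₗ[R] M) : Function.Exact (LinearMap.ker g).subtype g :=
  LinearMap.exact_iff.2 (by simp)

theorem inj_of_tor (a : A →ₗ[R] G) (g : G →ₗ[R] M) (ha : Function.Injective a)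
    (hag : Function.Exact a g) (hg : Function.Surjective g) (h : Tor1Zero R M X) :
    Function.Injective (LinearMap.rTensor X a) := by
  have h1 : Function.Injective (LinearMap.rTensor M (LinearMap.ker (cov R X)).subtype) :=
    h (ModuleCat.of R (X →₀ R)) (inferInstanceAs (Module.Flat R (X →₀ R))) (cov R X)
      (cov_surj R X)
  have h2 : Function.Injective (LinearMap.rTensor (X →₀ R) a) :=
    Module.Flat.rTensor_preserves_injective_linearMap a ha
  exact balance_aux (X' := LinearMap.ker (cov R X)) a g (LinearMap.ker (cov R X)).subtype (cov R X) hag hg (exact_ker_sub _)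
    (cov_surj R X) h2 h1

theorem tor_of_inj (a : A →ₗ[R] G) (g : G →ₗ[R] M)
    (hag : Function.Exact a g) (hg : Function.Surjective g) (hG : Tor1Zero R G X)
    (h : Function.Injective (LinearMap.rTensor X a)) : Tor1Zero R M X := by
  intro P hP q hq
  exact balance_aux _ q a g (exact_ker_sub q) hq hag hg (hG P hP q hq) h

theorem tor_flat (hG : Module.Flat R G) : Tor1Zero R G X := fun _ _ q _ =>
  Module.Flat.rTensor_preserves_injective_linearMap _ (LinearMap.ker q).injective_subtype

theorem inj_step {X' P : Type u} [AddCommGroup X'] [Module R X'] [AddCommGroup P] [Module R P]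
    (a : A →ₗ[R] G) (ha : Function.Injective a) (b : X' →ₗ[R] P) (hP : Module.Flat R P)
    (h : Function.Injective (LinearMap.rTensor A b)) :
    Function.Injective (LinearMap.rTensor X' a) := by
  have h' : Function.Injective (LinearMap.lTensor A b) :=
    (LinearMap.lTensor_inj_iff_rTensor_inj A b).2 h
  have h1 : Function.Injective (LinearMap.rTensor P a ∘ₗ LinearMap.lTensor A b) :=
    (Module.Flat.rTensor_preserves_injective_linearMap a ha).comp h'
  rw [LinearMap.rTensor_comp_lTensor, ← LinearMap.lTensor_comp_rTensor] at h1
  exact Function.Injective.of_comp (f := LinearMap.lTensor G b) h1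
end

/-- Iterated free syzygies. -/
noncomputable def syz (R : Type u) [CommRing R] (I : ModuleCat.{u} R) : ℕ → ModuleCat.{u} R
  | 0 => I
  | j + 1 => ModuleCat.of R (LinearMap.ker (cov R (syz R I j)))

theorem syz_step {R : Type u} [CommRing R] (I : ModuleCat.{u} R) (j : ℕ)
    {A G : Type u} [AddCommGroup A] [Module R A] [AddCommGroup G] [Module R G]
    (a : A →ₗ[R] G) (ha : Function.Injective a) (h : Tor1Zero R A (syz R I j)) :
    Function.Injective (LinearMap.rTensor (syz R I (j + 1)) a) :=
  inj_step (X' := LinearMap.ker (cov R (syz R I j))) a ha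
    (LinearMap.ker (cov R (syz R I j))).subtype (inferInstanceAs (Module.Flat R (_ →₀ R)))
    (h (ModuleCat.of R (syz R I j →₀ R))
      (inferInstanceAs (Module.Flat R (syz R I j →₀ R))) _ (cov_surj R _))

theorem tor_gflat {R : Type u} [CommRing R] (I : ModuleCat.{u} R) (hI : Module.Injective R I)
    (M : Type u) [AddCommGroup M] [Module R M] (hM : IsGFlat R M) (j : ℕ) :
    Tor1Zero R M (syz R I j) := by
  obtain ⟨F, d, hF, -, hex, ⟨e⟩, hT⟩ := hM
  have hexr : ∀ k, Function.Exact (LinearMap.range (d (k + 1))).subtype (d k).rangeRestrict := by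
    intro k
    rw [LinearMap.exact_iff, LinearMap.ker_rangeRestrict, Submodule.range_subtype, hex]
  have key : ∀ k, Function.Injective
      (LinearMap.rTensor (syz R I j) (LinearMap.range (d (k + 1))).subtype) := by
    induction j with
    | zero =>
      intro k
      change Function.Injective (LinearMap.rTensor I (LinearMap.range (d (k + 1))).subtype)
      rw [injective_iff_map_eq_zero]
      intro x hx
      obtain ⟨y, rfl⟩ :=
        LinearMap.rTensor_surjective I (d (k + 1)).surjective_rangeRestrict x
      rw [← LinearMap.comp_apply, ← LinearMap.rTensor_comp] at hx
      have hy : y ∈ LinearMap.ker (LinearMap.rTensor I (d (k + 1))) := hx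
      rw [hT I hI] at hy
      obtain ⟨z, rfl⟩ := hy
      have hz : (d (k + 1)).rangeRestrict ∘ₗ d (k + 1 + 1) = 0 := by
        ext w
        have : d (k + 1 + 1) w ∈ LinearMap.ker (d (k + 1)) := by
          rw [hex]; exact ⟨w, rfl⟩
        simpa using this
      rw [← LinearMap.comp_apply, ← LinearMap.rTensor_comp, hz]
      simp
    | succ j ih =>
      intro k
      refine syz_step I j _ (Submodule.injective_subtype _) ?_
      exact tor_of_inj _ _ (hexr (k + 1)) (d (k + 1)).surjective_rangeRestrict
        (tor_flat (hF _)) (ih (k + 1))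
  refine tor_of_inj (LinearMap.range (d (0 + 1))).subtype (e.symm.toLinearMap ∘ₗ (d 0).rangeRestrict)
    ?_ (e.symm.surjective.comp (d 0).surjective_rangeRestrict) (tor_flat (hF _)) (key 0)
  intro x
  rw [← hexr 0 x]
  simp

theorem tor_gfd {R : Type u} [CommRing R] (I : ModuleCat.{u} R) (hI : Module.Injective R I)
    (n : ℕ) : ∀ (M : ModuleCat.{u} R), GfdLE R n M → Tor1Zero R M (syz R I n) := by
  induction n with
  | zero => exact fun M hM => tor_gflat I hI M hM 0
  | succ n ih =>
    intro M hM
    rw [GfdLE] at hM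
    obtain ⟨G, p, hG, hp, hK⟩ := hM
    have h1 : Tor1Zero R (LinearMap.ker p) (syz R I n) := ih (ModuleCat.of R (LinearMap.ker p)) hK
    have h2 : Function.Injective
        (LinearMap.rTensor (syz R I (n + 1)) (LinearMap.ker p).subtype) :=
      syz_step I n _ (Submodule.injective_subtype _) h1
    exact tor_of_inj (LinearMap.ker p).subtype p (exact_ker_sub p) hp (tor_gflat I hI G hG _)
      h2

/-- Over a ring of finite Gorenstein weak dimension, a module `N` admitting a
short exact sequence `0 → N → F → N → 0` with `F` flat satisfies `Tor₁^R(N, I) = 0` for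
every injective `I`, hence is strongly Gorenstein flat. -/
theorem stmt9 (R : Type u) [CommRing R]
    (hwd : ∃ n : ℕ, ∀ M : ModuleCat.{u} R, GfdLE R n M)
    (N : Type u) [AddCommGroup N] [Module R N]
    (F : ModuleCat.{u} R) (hF : Module.Flat R F)
    (i : N →ₗ[R] F) (p : F →ₗ[R] N)
    (hi : Function.Injective i) (hp : Function.Surjective p)
    (he : LinearMap.range i = LinearMap.ker p) :
    (∀ I : ModuleCat.{u} R, Module.Injective R I → Tor1Zero R N I) ∧
      IsSGFlat R N := by
  have hex : Function.Exact i p := LinearMap.exact_iff.2 he.symm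
  obtain ⟨n, hn⟩ := hwd
  have hTor : ∀ I : ModuleCat.{u} R, Module.Injective R I → Tor1Zero R N I := by
    intro I hI
    have hdown : ∀ j, Tor1Zero R N (syz R I j) → Tor1Zero R N I := by
      intro j
      induction j with
      | zero => exact id
      | succ j ih =>
        intro h
        apply ih
        have h1 : Function.Injective
            (LinearMap.rTensor (LinearMap.ker (cov R (syz R I j))) i) :=
          inj_of_tor i p hi hex hp h
        have h2 : Function.Injective
            (LinearMap.rTensor N (LinearMap.ker (cov R (syz R I j))).subtype) :=
          inj_step _ (Submodule.injective_subtype _) i hF h1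
        exact tor_of_inj i p hex hp (tor_flat hF)
          (balance_aux i p _ _ hex hp (exact_ker_sub _) (cov_surj R (syz R I j))
            (Module.Flat.rTensor_preserves_injective_linearMap i hi) h2)
    exact hdown n (tor_gfd I hI n (ModuleCat.of R N) (hn _))
  refine ⟨hTor, F, hF, i ∘ₗ p, ?_, ?_, ?_, ?_⟩
  · ext x
    simp [hex.apply_apply_eq_zero]
  · rw [LinearMap.ker_comp_of_ker_eq_bot _ (LinearMap.ker_eq_bot.2 hi),
      LinearMap.range_comp_of_range_eq_top _ (LinearMap.range_eq_top.2 hp), he]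
  · rw [LinearMap.range_comp_of_range_eq_top _ (LinearMap.range_eq_top.2 hp)]
    exact ⟨LinearEquiv.ofInjective i hi⟩
  · intro I hI
    have hinj := inj_of_tor i p hi hex hp (hTor I hI)
    rw [LinearMap.rTensor_comp, LinearMap.ker_comp_of_ker_eq_bot _ (LinearMap.ker_eq_bot.2 hinj),
      LinearMap.range_comp_of_range_eq_top _
        (LinearMap.range_eq_top.2 (LinearMap.rTensor_surjective I hp))]
    exact LinearMap.exact_iff.1 (rTensor_exact I hex hp)
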